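/- Let n ≥ 2, l ∈ ℕ₀ and 0 < p < ∞ with p(n−1+l) > n. There is a constant C > 0 such that for all w = (y,s) ∈ ℝ^{n+1}_+ and all t > 0: M_p(f_{w,l}, t) = (∫_{ℝ^n} |f_{w,l}(x,t)|^p dx)^{1/p} ≤ C (t+s)^{n/p − (n−1+l)}. -/

import Mathlib

open MeasureTheory Real Set
open scoped ENNReal

noncomputable section

abbrev Euc (N : ℕ) : Type := EuclideanSpace ℝ (Fin N)

/-- The point `(x, t) ∈ ℝ^{n+1}`. -/
def pt {n : ℕ} (x : Euc n) (t : ℝ) : Euc (n + 1) :=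
  (EuclideanSpace.equiv (Fin (n + 1)) ℝ).symm (Fin.snoc (fun i => x i) t)

/-- horizontal part of a point of ℝ^{n+1} -/
def xp {n : ℕ} (z : Euc (n + 1)) : Euc n :=
  (EuclideanSpace.equiv (Fin n) ℝ).symm (fun i => z i.castSucc)

/-- vertical part of a point of ℝ^{n+1} -/
def tp {n : ℕ} (z : Euc (n + 1)) : ℝ := z (Fin.last n)

/-- The upper half space ℝ^{n+1}_+. -/
def upperHS (n : ℕ) : Set (Euc (n + 1)) := {z | 0 < tp z}

/-- |z - w̄| where z = (x,t), w̄ = (y, -s): Euclidean distance -/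
def dB {n : ℕ} (x : Euc n) (t : ℝ) (y : Euc n) (s : ℝ) : ℝ :=
  dist (pt x t) (pt y (-s))

/-- the measure t^λ dx dt on ℝ^n × (0,∞), identified with ℝ^{n+1}_+ -/
def mLam (n : ℕ) (l : ℝ) : Measure (Euc n × ℝ) :=
  ((volume : Measure (Euc n)).prod ((volume : Measure ℝ).restrict (Ioi 0))).withDensity
    (fun zt => ENNReal.ofReal (zt.2 ^ l))

/-- second derivative of `f` at `z` along direction `v` -/
def d2 {V : Type*} [NormedAddCommGroup V] [NormedSpace ℝ V] (f : V → ℝ) (z v : V) : ℝ :=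
  iteratedFDeriv ℝ 2 f z ![v, v]

/-- `f` is harmonic on a subset of ℝ^N : twice continuously differentiable with
vanishing Laplacian. -/
def HarmonicOnE {N : ℕ} (f : Euc N → ℝ) (s : Set (Euc N)) : Prop :=
  ContDiffOn ℝ 2 f s ∧ ∀ z ∈ s, ∑ i, d2 f z (EuclideanSpace.single i 1) = 0

/-- `f` is harmonic on (ℝ^{n+1}_+)^m, viewed as an open subset of ℝ^{m(n+1)}. -/
def HarmonicOnM {n m : ℕ} (f : (Fin m → Euc (n + 1)) → ℝ) : Prop :=
  ContDiffOn ℝ 2 f {z | ∀ j, z j ∈ upperHS n} ∧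
  ∀ z ∈ {z : Fin m → Euc (n + 1) | ∀ j, z j ∈ upperHS n},
    ∑ j, ∑ i, d2 f z (Function.update (0 : Fin m → Euc (n + 1)) j (EuclideanSpace.single i 1)) = 0

/-- `f` is harmonic in each variable separately on (ℝ^{n+1}_+)^m -/
def HarmonicSep {n m : ℕ} (f : (Fin m → Euc (n + 1)) → ℝ) : Prop :=
  ∀ (j : Fin m) (z : Fin m → Euc (n + 1)), (∀ k, z k ∈ upperHS n) →
    HarmonicOnE (fun w => f (Function.update z j w)) (upperHS n)

/-- the closed cube centered at (y,s) with side length s -/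
def Qcube {n : ℕ} (y : Euc n) (s : ℝ) : Set (Euc (n + 1)) :=
  {z | (∀ i : Fin n, |z (Fin.castSucc i) - y i| ≤ s / 2) ∧ |tp z - s| ≤ s / 2}

/-- the A^p_λ (quasi)-norm, raised to the power p -/
def normAp (n : ℕ) (f : Euc (n + 1) → ℝ) (p l : ℝ) : ℝ≥0∞ :=
  ∫⁻ zt : Euc n × ℝ, ENNReal.ofReal (|f (pt zt.1 zt.2)| ^ p) ∂(mLam n l)

/-- membership in the harmonic Bergman space A^p_λ -/
def memAp (n : ℕ) (f : Euc (n + 1) → ℝ) (p l : ℝ) : Prop :=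
  HarmonicOnE f (upperHS n) ∧ normAp n f p l < ⊤


/-- f_{w,l}(z) = ∂^l/∂t^l (|z - w̄|^{1-n}) for w = (y,s), z = (x,t) -/
def fwl (n l : ℕ) (y : Euc n) (s : ℝ) (x : Euc n) (t : ℝ) : ℝ :=
  iteratedDeriv l (fun τ => dB x τ y s ^ (1 - (n : ℝ))) t

/-- Every derivative of `v ^ m * (A + v ^ 2) ^ β` is bounded, uniformly in `A`, by the power of
`A + v ^ 2` of the same homogeneity. -/
theorem exists_abs_iteratedDeriv_le (l m : ℕ) (β : ℝ) :
    ∃ C : ℝ, 0 ≤ C ∧ ∀ A v : ℝ, 0 ≤ A → 0 < v →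
      |iteratedDeriv l (fun v => v ^ m * (A + v ^ 2) ^ β) v| ≤
        C * (A + v ^ 2) ^ (β + (m : ℝ) / 2 - (l : ℝ) / 2) := by
  induction l generalizing m β with
  | zero =>
    refine ⟨1, zero_le_one, fun A v hA hv => ?_⟩
    have hB : 0 < A + v ^ 2 := by positivity
    have hm : v ^ m ≤ (A + v ^ 2) ^ ((m : ℝ) / 2) := by
      have h1 : v ^ m = (v ^ 2) ^ ((m : ℝ) / 2) := by
        rw [← Real.rpow_natCast v 2, ← Real.rpow_mul hv.le, ← Real.rpow_natCast]
        congr 1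
        push_cast
        ring
      rw [h1]
      gcongr
      linarith
    rw [iteratedDeriv_zero, abs_of_nonneg (by positivity)]
    have h2 : β + (m : ℝ) / 2 - ((0 : ℕ) : ℝ) / 2 = (m : ℝ) / 2 + β := by
      push_cast
      ring
    rw [h2, Real.rpow_add hB, one_mul]
    gcongr
  | succ l ih =>
    obtain ⟨C₁, hC₁, h₁⟩ := ih (m - 1) β
    obtain ⟨C₂, hC₂, h₂⟩ := ih (m + 1) (β - 1)
    refine ⟨m * C₁ + |2 * β| * C₂, by positivity, fun A v hA hv => ?_⟩
    have hsmooth : ∀ (k : ℕ) (γ : ℝ),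
        ContDiffAt ℝ l (fun v : ℝ => v ^ k * (A + v ^ 2) ^ γ) v := fun k γ => by
      have hne : A + v ^ 2 ≠ 0 := by positivity
      exact (contDiffAt_id.pow k).mul
        ((contDiffAt_const.add (contDiffAt_id.pow 2)).rpow_const_of_ne hne)
    have hderiv : deriv (fun v : ℝ => v ^ m * (A + v ^ 2) ^ β) =ᶠ[nhds v]
        fun v => (m : ℝ) * (v ^ (m - 1) * (A + v ^ 2) ^ β) +
          (2 * β) * (v ^ (m + 1) * (A + v ^ 2) ^ (β - 1)) := by
      filter_upwards [lt_mem_nhds hv] with u hu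
      have hne : A + u ^ 2 ≠ 0 := by positivity
      have h := (hasDerivAt_pow m u).mul
        (((hasDerivAt_pow 2 u).const_add A).rpow_const (p := β) (Or.inl hne))
      refine (HasDerivAt.deriv h).trans ?_
      push_cast
      ring
    rw [iteratedDeriv_succ', hderiv.iteratedDeriv_eq l,
      iteratedDeriv_fun_add (contDiffAt_const.mul (hsmooth _ _))
        (contDiffAt_const.mul (hsmooth _ _)),
      iteratedDeriv_const_mul_field, iteratedDeriv_const_mul_field]
    refine (abs_add_le _ _).trans ?_
    rw [abs_mul, abs_mul, add_mul, Nat.abs_cast]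
    refine add_le_add ?_ ?_
    · rcases m with _ | m
      · simp
      · rw [mul_assoc]
        refine mul_le_mul_of_nonneg_left ((h₁ A v hA hv).trans_eq ?_) (by positivity)
        congr 2
        push_cast [Nat.add_sub_cancel]
        ring
    · rw [mul_assoc]
      refine mul_le_mul_of_nonneg_left ((h₂ A v hA hv).trans_eq ?_) (abs_nonneg _)
      congr 2
      push_cast
      ring

theorem dB_eq_sqrt {n : ℕ} (x : Euc n) (t : ℝ) (y : Euc n) (s : ℝ) :
    dB x t y s = √(‖x - y‖ ^ 2 + (t + s) ^ 2) := by
  rw [dB, EuclideanSpace.dist_eq, Fin.sum_univ_castSucc, EuclideanSpace.norm_sq_eq]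
  simp [pt, Real.dist_eq, sq_abs]

theorem exists_abs_fwl_le (n l : ℕ) :
    ∃ C : ℝ, 0 ≤ C ∧ ∀ (y x : Euc n) (s t : ℝ), 0 < t + s →
      |fwl n l y s x t| ≤
        C * (‖x - y‖ ^ 2 + (t + s) ^ 2) ^ (-((n : ℝ) - 1 + l) / 2) := by
  obtain ⟨C, hC, h⟩ := exists_abs_iteratedDeriv_le l 0 ((1 - (n : ℝ)) / 2)
  refine ⟨C, hC, fun y x s t hst => ?_⟩
  have hf : (fun τ => dB x τ y s ^ (1 - (n : ℝ))) =
      fun τ => (fun v : ℝ => v ^ 0 * (‖x - y‖ ^ 2 + v ^ 2) ^ ((1 - (n : ℝ)) / 2)) (τ + s) := by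
    ext τ
    simp only [dB_eq_sqrt, pow_zero, one_mul]
    rw [Real.sqrt_eq_rpow, ← Real.rpow_mul (by positivity)]
    congr 1
    ring
  rw [fwl, hf, iteratedDeriv_comp_add_const l
    (fun v : ℝ => v ^ 0 * (‖x - y‖ ^ 2 + v ^ 2) ^ ((1 - (n : ℝ)) / 2)) s]
  refine (h (‖x - y‖ ^ 2) (t + s) (by positivity) hst).trans_eq ?_
  congr 2
  push_cast
  ring

theorem lintegral_norm_sub_sq_add_sq_rpow (n : ℕ) (r : ℝ) (y : Euc n) {u : ℝ} (hu : 0 < u) :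
    ∫⁻ x : Euc n, ENNReal.ofReal ((‖x - y‖ ^ 2 + u ^ 2) ^ (-r / 2)) =
      ENNReal.ofReal (u ^ ((n : ℝ) - r)) *
        ∫⁻ x : Euc n, ENNReal.ofReal ((1 + ‖x‖ ^ 2) ^ (-r / 2)) := by
  rw [lintegral_sub_right_eq_self
    (fun x : Euc n => ENNReal.ofReal ((‖x‖ ^ 2 + u ^ 2) ^ (-r / 2))) y]
  have hpt : ∀ x : Euc n, ENNReal.ofReal ((‖x‖ ^ 2 + u ^ 2) ^ (-r / 2)) =
      ENNReal.ofReal (u ^ (-r)) * ENNReal.ofReal ((1 + ‖u⁻¹ • x‖ ^ 2) ^ (-r / 2)) := fun x => by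
    rw [← ENNReal.ofReal_mul (by positivity)]
    congr 1
    have h1 : ‖x‖ ^ 2 + u ^ 2 = u ^ (2 : ℝ) * (1 + ‖u⁻¹ • x‖ ^ 2) := by
      rw [norm_smul, Real.norm_of_nonneg (by positivity), Real.rpow_two]
      field_simp
      ring
    rw [h1, Real.mul_rpow (by positivity) (by positivity), ← Real.rpow_mul hu.le]
    congr 2
    ring
  simp_rw [hpt]
  rw [lintegral_const_mul _ (by fun_prop)]
  have hmap := Measure.map_addHaar_smul (volume : Measure (Euc n)) (inv_ne_zero hu.ne')
  rw [← lintegral_map (f := fun x : Euc n => ENNReal.ofReal ((1 + ‖x‖ ^ 2) ^ (-r / 2)))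
    (g := fun x => u⁻¹ • x) (by fun_prop) (by fun_prop), hmap, lintegral_smul_measure,
    smul_eq_mul, ← mul_assoc, ← ENNReal.ofReal_mul (by positivity)]
  congr 2
  rw [finrank_euclideanSpace_fin, abs_of_pos (by positivity), inv_pow, inv_inv,
    ← Real.rpow_natCast, ← Real.rpow_add hu]
  congr 1
  ring

/-- the estimate M_p(f_{w,l}, t) ≤ C (t+s)^{n/p - (n-1+l)}. -/
theorem stmt12 (n : ℕ) (hn : 2 ≤ n) (l : ℕ) (p : ℝ) (hp : 0 < p)
    (hpl : p * ((n : ℝ) - 1 + l) > n) :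
    ∃ C : ℝ, 0 < C ∧ ∀ (y : Euc n) (s t : ℝ), 0 < s → 0 < t →
      (∫⁻ x : Euc n, ENNReal.ofReal (|fwl n l y s x t| ^ p)) ^ (1 / p) ≤
        ENNReal.ofReal (C * (t + s) ^ ((n : ℝ) / p - ((n : ℝ) - 1 + l))) := by
  obtain ⟨C, hC, h⟩ := exists_abs_fwl_le n l
  set q : ℝ := (n : ℝ) - 1 + l with hq
  set I : ℝ≥0∞ := ∫⁻ x : Euc n, ENNReal.ofReal ((1 + ‖x‖ ^ 2) ^ (-(p * q) / 2)) with hI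
  have hfin : I ≠ ⊤ := by
    have hint : Integrable (fun x : Euc n => (1 + ‖x‖ ^ 2) ^ (-(p * q) / 2)) :=
      integrable_rpow_neg_one_add_norm_sq (by rw [finrank_euclideanSpace_fin]; exact hpl)
    exact hint.lintegral_lt_top.ne
  set K : ℝ := C ^ p * I.toReal with hK
  have hK0 : 0 ≤ K := by positivity
  refine ⟨K ^ (1 / p) + 1, by positivity, fun y s t hs ht => ?_⟩
  have hu : 0 < t + s := by positivity
  have hle : ∫⁻ x : Euc n, ENNReal.ofReal (|fwl n l y s x t| ^ p) ≤
      ENNReal.ofReal (K * (t + s) ^ ((n : ℝ) - p * q)) := by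
    calc ∫⁻ x : Euc n, ENNReal.ofReal (|fwl n l y s x t| ^ p)
        ≤ ∫⁻ x : Euc n, ENNReal.ofReal (C ^ p) *
            ENNReal.ofReal ((‖x - y‖ ^ 2 + (t + s) ^ 2) ^ (-(p * q) / 2)) := by
          refine lintegral_mono fun x => ?_
          rw [← ENNReal.ofReal_mul (by positivity)]
          refine ENNReal.ofReal_le_ofReal ?_
          refine (Real.rpow_le_rpow (abs_nonneg _) (h y x s t hu) hp.le).trans_eq ?_
          rw [Real.mul_rpow hC (by positivity), ← Real.rpow_mul (by positivity)]
          congr 2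
          ring
      _ = ENNReal.ofReal (K * (t + s) ^ ((n : ℝ) - p * q)) := by
          rw [lintegral_const_mul _ (by fun_prop), lintegral_norm_sub_sq_add_sq_rpow n _ y hu,
            ← hI, ← ENNReal.ofReal_toReal hfin, ← ENNReal.ofReal_mul (by positivity),
            ← ENNReal.ofReal_mul (by positivity)]
          congr 1
          rw [hK]
          ring
  refine (ENNReal.rpow_le_rpow hle (by positivity)).trans ?_
  rw [ENNReal.ofReal_rpow_of_nonneg (by positivity) (by positivity)]
  refine ENNReal.ofReal_le_ofReal ?_
  rw [Real.mul_rpow hK0 (by positivity), ← Real.rpow_mul hu.le]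
  have hexp : ((n : ℝ) - p * q) * (1 / p) = (n : ℝ) / p - q := by
    field_simp
  rw [hexp]
  gcongr
  linarith

end
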